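/- For n ∈ ℕ, n ≥ 1, let ε_n : Lsc(]0,1[,ℕ) → M_n be the map sending a finite-valued lower semicontinuous f to the largest element of {g ∈ M_n | g ≪ f}. Then ε_n is order-preserving and super-additive (ε_n(f) + ε_n(f') ≤ ε_n(f + f') for all f, f'), and its restriction to ∪_{l < n−1} M_l is additive: ε_n(f + f') = ε_n(f) + ε_n(f') for all f, f' ∈ ∪_{l < n−1} M_l (with the convention M_0 := {0}). -/

import Mathlib

open Set

/-- The open unit interval `]0,1[` as a topological space. -/
abbrev Io01 : Type := ↥(Set.Ioo (0 : ℝ) 1)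

/-- Lower semicontinuity for `ℕ̄`-valued functions. -/
def IsLscFn {X : Type*} [TopologicalSpace X] (f : X → ℕ∞) : Prop :=
  ∀ m : ℕ, IsOpen {t | (m : ℕ∞) < f t}

/-- The way-below relation on `Lsc(]0,1[, ℕ̄)`, phrased inside the ambient function space:
`f ≪ g` iff every increasing sequence of lsc functions whose pointwise supremum dominates `g`
eventually dominates `f`. -/
def WayBelowLsc (f g : Io01 → ℕ∞) : Prop :=
  ∀ h : ℕ → (Io01 → ℕ∞), (∀ m, IsLscFn (h m)) → Monotone h →
    (∀ t, g t ≤ ⨆ m, h m t) → ∃ m, f ≤ h m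

/-- `M_n`: finite-valued lsc functions constant on each open dyadic interval of size `1/2^n`. -/
def Mdyadic (n : ℕ) : Set (Io01 → ℕ∞) :=
  {f | IsLscFn f ∧ (∀ t, f t ≠ ⊤) ∧
    ∀ k : ℕ, 1 ≤ k → k ≤ 2 ^ n → ∀ s t : Io01,
      (s : ℝ) ∈ Set.Ioo (((k : ℝ) - 1) / 2 ^ n) ((k : ℝ) / 2 ^ n) →
      (t : ℝ) ∈ Set.Ioo (((k : ℝ) - 1) / 2 ^ n) ((k : ℝ) / 2 ^ n) → f s = f t}

/-- The union `∪_{l<n-1} M_l` with the convention `M_0 := {0}`. -/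
def MdyadicUnion (n : ℕ) : Set (Io01 → ℕ∞) :=
  insert 0 (⋃ l ∈ {l : ℕ | 1 ≤ l ∧ l + 1 < n}, Mdyadic l)

open Filter Topology

noncomputable def extF (f : Io01 → ℕ∞) (x : ℝ) : ℕ∞ :=
  open Classical in if h : x ∈ Set.Ioo (0 : ℝ) 1 then f ⟨x, h⟩ else 0

lemma extF_coe (f : Io01 → ℕ∞) (t : Io01) : extF f (t : ℝ) = f t := by
  unfold extF
  rw [dif_pos t.2]

lemma extF_out (f : Io01 → ℕ∞) {x : ℝ} (h : x ∉ Set.Ioo (0 : ℝ) 1) : extF f x = 0 := by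
  unfold extF
  rw [dif_neg h]

lemma extF_add (f g : Io01 → ℕ∞) (x : ℝ) : extF (f + g) x = extF f x + extF g x := by
  by_cases h : x ∈ Set.Ioo (0 : ℝ) 1
  · simp [extF, h]
  · simp [extF_out _ h]

lemma extF_ne_top {f : Io01 → ℕ∞} (hf : ∀ t, f t ≠ ⊤) (x : ℝ) : extF f x ≠ ⊤ := by
  by_cases h : x ∈ Set.Ioo (0 : ℝ) 1
  · simpa [extF, h] using hf ⟨x, h⟩
  · simp [extF_out _ h]

/-- lsc for finite levels -/
lemma lsc_ev {f : Io01 → ℕ∞} (hf : IsLscFn f) (x : ℝ) (c : ℕ) (hc : (c : ℕ∞) ≤ extF f x) :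
    ∀ᶠ y in 𝓝 x, (c : ℕ∞) ≤ extF f y := by
  rcases c with _ | c
  · simp
  · by_cases h : x ∈ Set.Ioo (0 : ℝ) 1
    · have ho : IsOpen ((fun t : Io01 => (t : ℝ)) '' {t | (c : ℕ∞) < f t}) :=
        (isOpen_Ioo.isOpenEmbedding_subtypeVal).isOpenMap _ (hf c)
      have hx : x ∈ ((fun t : Io01 => (t : ℝ)) '' {t | (c : ℕ∞) < f t}) := by
        refine ⟨⟨x, h⟩, ?_, rfl⟩
        have := extF_coe f ⟨x, h⟩
        simp only at this
        rw [this] at hc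
        refine lt_of_lt_of_le ?_ hc
        exact_mod_cast Nat.lt_succ_self c
      filter_upwards [ho.mem_nhds hx] with y hy
      obtain ⟨t, ht, rfl⟩ := hy
      simp only [extF_coe]
      push_cast
      exact Order.add_one_le_of_lt ht
    · rw [extF_out _ h] at hc
      simp at hc

lemma lsc_of_ev {f : Io01 → ℕ∞}
    (hf : ∀ (x : Io01) (c : ℕ), (c : ℕ∞) < f x → ∀ᶠ y in 𝓝 (x : ℝ), (c : ℕ∞) < extF f y) :
    IsLscFn f := by
  intro m
  rw [isOpen_iff_mem_nhds]
  intro t ht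
  have h1 := hf t m ht
  have h2 : Tendsto (fun s : Io01 => (s : ℝ)) (𝓝 t) (𝓝 (t : ℝ)) := continuous_subtype_val.tendsto t
  have h3 := h2.eventually h1
  filter_upwards [h3] with s hs
  simpa [extF_coe] using hs

lemma lsc_ev' {f : Io01 → ℕ∞} (hf : IsLscFn f) (hft : ∀ t, f t ≠ ⊤) (x : ℝ) :
    ∀ᶠ y in 𝓝 x, extF f x ≤ extF f y := by
  obtain ⟨c, hc⟩ := ENat.ne_top_iff_exists.1 (extF_ne_top hft x)
  have := lsc_ev hf x c hc.le
  rwa [hc] at this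

lemma lsc_add {f g : Io01 → ℕ∞} (hf : IsLscFn f) (hft : ∀ t, f t ≠ ⊤)
    (hg : IsLscFn g) (hgt : ∀ t, g t ≠ ⊤) : IsLscFn (f + g) := by
  apply lsc_of_ev
  intro x c hc
  filter_upwards [lsc_ev' hf hft x, lsc_ev' hg hgt x] with y h1 h2
  rw [extF_add]
  refine lt_of_lt_of_le hc ?_
  rw [extF_coe] at h1 h2
  exact add_le_add h1 h2

lemma add_fin {f g : Io01 → ℕ∞} (hft : ∀ t, f t ≠ ⊤) (hgt : ∀ t, g t ≠ ⊤) :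
    ∀ t, (f + g) t ≠ ⊤ := by
  intro t
  simp [hft t, hgt t]

lemma wb_of_ev {f g : Io01 → ℕ∞} (hft : ∀ t, f t ≠ ⊤)
    (h : ∀ x ∈ Set.Icc (0 : ℝ) 1, ∀ᶠ y in 𝓝 x, extF g y ≤ extF f x) : WayBelowLsc g f := by
  intro H hH hmono hsup
  have key : ∀ x ∈ Set.Icc (0 : ℝ) 1, ∃ m, ∀ᶠ y in 𝓝 x, extF g y ≤ extF (H m) y := by
    intro x hx
    obtain ⟨c, hc⟩ := ENat.ne_top_iff_exists.1 (extF_ne_top hft x)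
    have h1 : ∃ m, (c : ℕ∞) ≤ extF (H m) x := by
      by_cases hx' : x ∈ Set.Ioo (0 : ℝ) 1
      · have h2 := hsup ⟨x, hx'⟩
        have h3 : extF f x = f ⟨x, hx'⟩ := extF_coe f ⟨x, hx'⟩
        rw [← h3, ← hc] at h2
        rcases c with _ | c
        · exact ⟨0, by simp⟩
        · have h4 : (c : ℕ∞) < ⨆ m, H m ⟨x, hx'⟩ := by
            refine lt_of_lt_of_le ?_ h2
            exact_mod_cast Nat.lt_succ_self c
          obtain ⟨m, hm⟩ := lt_iSup_iff.1 h4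
          refine ⟨m, ?_⟩
          have h5 : extF (H m) x = H m ⟨x, hx'⟩ := extF_coe (H m) ⟨x, hx'⟩
          rw [h5]
          push_cast
          exact Order.add_one_le_of_lt hm
      · rw [extF_out _ hx'] at hc
        exact ⟨0, by rw [hc]; simp⟩
    obtain ⟨m, hm⟩ := h1
    refine ⟨m, ?_⟩
    filter_upwards [h x hx, lsc_ev (hH m) x c hm] with y h1 h2
    rw [← hc] at h1
    exact h1.trans h2
  have hex : ∃ m, ∀ x ∈ Set.Icc (0 : ℝ) 1, extF g x ≤ extF (H m) x := by
    have hmono' : ∀ {a b : ℕ}, a ≤ b → ∀ x, extF (H a) x ≤ extF (H b) x := by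
      intro a b hab x
      by_cases hx' : x ∈ Set.Ioo (0 : ℝ) 1
      · have := hmono hab ⟨x, hx'⟩
        simpa [extF, hx'] using this
      · simp [extF_out _ hx']
    refine (isCompact_Icc (a := (0 : ℝ)) (b := 1)).induction_on
      (p := fun s => ∃ m, ∀ x ∈ s, extF g x ≤ extF (H m) x) ⟨0, by simp⟩ ?_ ?_ ?_
    · rintro s t hst ⟨m, hm⟩
      exact ⟨m, fun x hx => hm x (hst hx)⟩
    · rintro s t ⟨m, hm⟩ ⟨m', hm'⟩
      refine ⟨max m m', ?_⟩
      rintro x (hx | hx)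
      · exact (hm x hx).trans (hmono' (le_max_left _ _) x)
      · exact (hm' x hx).trans (hmono' (le_max_right _ _) x)
    · intro x hx
      obtain ⟨m, hm⟩ := key x hx
      exact ⟨_, mem_nhdsWithin_of_mem_nhds hm, m, fun y hy => hy⟩
  obtain ⟨m, hm⟩ := hex
  refine ⟨m, fun t => ?_⟩
  have := hm t ⟨t.2.1.le, t.2.2.le⟩
  simpa [extF_coe] using this

lemma ev_of_wb {f g : Io01 → ℕ∞} (hf : IsLscFn f)
    (h : WayBelowLsc g f) (x : ℝ) : ∀ᶠ y in 𝓝 x, extF g y ≤ extF f x := by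
  classical
  obtain ⟨m, hm⟩ := h (fun m t => if |(t : ℝ) - x| ≤ 1 / ((m : ℝ) + 1) then min (f t) (extF f x) else f t)
    (by
      intro m c
      by_cases hc : (c : ℕ∞) < extF f x
      · convert hf c using 1
        ext t
        simp only [Set.mem_ofPred_eq]
        split_ifs
        · simp [hc]
        · rfl
      · have ho : IsOpen {t : Io01 | 1 / ((m : ℝ) + 1) < |(t : ℝ) - x|} :=
          isOpen_lt continuous_const (by fun_prop)
        convert (hf c).inter ho using 1
        ext t
        simp only [Set.mem_ofPred_eq, Set.mem_inter_iff]
        split_ifs with h1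
        · simp only [lt_min_iff, hc, and_false, not_lt.2 h1]
        · simp only [not_le.1 h1, and_true])
    (by
      intro a b hab t
      have hab' : 1 / ((b : ℝ) + 1) ≤ 1 / ((a : ℝ) + 1) := by
        have : (a : ℝ) ≤ b := by exact_mod_cast hab
        gcongr
      dsimp only
      split_ifs with h1 h2 h2
      · exact le_rfl
      · exact min_le_left _ _
      · exact absurd (h2.trans hab') h1
      · exact le_rfl)
    (by
      intro t
      by_cases htx : (t : ℝ) = x
      · refine le_trans ?_ (le_iSup _ 0)
        rw [← htx, extF_coe]
        simp
      · have hpos : 0 < |(t : ℝ) - x| := abs_pos.2 (sub_ne_zero.2 htx)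
        obtain ⟨m, hm⟩ := exists_nat_one_div_lt hpos
        refine le_trans ?_ (le_iSup _ m)
        rw [if_neg (not_le.2 hm)])
  have hpos : (0 : ℝ) < 1 / ((m : ℝ) + 1) := by positivity
  filter_upwards [Metric.ball_mem_nhds x hpos] with y hy
  rw [Metric.mem_ball, Real.dist_eq] at hy
  by_cases hy' : y ∈ Set.Ioo (0 : ℝ) 1
  · have h1 := hm ⟨y, hy'⟩
    dsimp only at h1
    rw [if_pos hy.le] at h1
    have h3 : extF g y = g ⟨y, hy'⟩ := extF_coe g ⟨y, hy'⟩
    rw [h3]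
    exact h1.trans (min_le_right _ _)
  · simp [extF_out _ hy']

lemma wb_add {f f' g g' : Io01 → ℕ∞} (hf : IsLscFn f) (hft : ∀ t, f t ≠ ⊤)
    (hf' : IsLscFn f') (hft' : ∀ t, f' t ≠ ⊤) (h : WayBelowLsc g f) (h' : WayBelowLsc g' f') :
    WayBelowLsc (g + g') (f + f') := by
  apply wb_of_ev (add_fin hft hft')
  intro x _
  filter_upwards [ev_of_wb hf h x, ev_of_wb hf' h' x] with y h1 h2
  rw [extF_add, extF_add]
  exact add_le_add h1 h2

lemma Mdyadic_add {n : ℕ} {f g : Io01 → ℕ∞} (hf : f ∈ Mdyadic n) (hg : g ∈ Mdyadic n) :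
    f + g ∈ Mdyadic n := by
  refine ⟨lsc_add hf.1 hf.2.1 hg.1 hg.2.1, add_fin hf.2.1 hg.2.1, ?_⟩
  intro k h1 h2 s t hs ht
  simp [hf.2.2 k h1 h2 s t hs ht, hg.2.2 k h1 h2 s t hs ht]

structure Grid (N : ℕ) (F : ℝ → ℕ∞) : Prop where
  pos : 0 < N
  lsc : ∀ x, ∀ᶠ y in 𝓝 x, F x ≤ F y
  const : ∀ (k : ℤ) (x y : ℝ), (k : ℝ) < N * x → N * x < k + 1 → (k : ℝ) < N * y →
    N * y < k + 1 → F x = F y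

lemma grid_of_mem {n : ℕ} {f : Io01 → ℕ∞} (hf : f ∈ Mdyadic n) : Grid (2 ^ n) (extF f) := by
  refine ⟨by positivity, lsc_ev' hf.1 hf.2.1, ?_⟩
  intro k x y h1 h2 h3 h4
  push_cast at h1 h2 h3 h4
  have hp : (0 : ℝ) < 2 ^ n := by positivity
  by_cases hk : 0 ≤ k ∧ k < 2 ^ n
  · obtain ⟨hk0, hk1⟩ := hk
    lift k to ℕ using hk0
    have hk1' : k + 1 ≤ 2 ^ n := by
      have : k < 2 ^ n := by exact_mod_cast hk1
      omega
    have hk2 : (k : ℝ) + 1 ≤ 2 ^ n := by exact_mod_cast hk1'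
    have hk3 : (0 : ℝ) ≤ k := by positivity
    push_cast at h1 h2 h3 h4
    have hx : x ∈ Set.Ioo (0 : ℝ) 1 := ⟨by by_contra h; nlinarith, by by_contra h; nlinarith⟩
    have hy : y ∈ Set.Ioo (0 : ℝ) 1 := ⟨by by_contra h; nlinarith, by by_contra h; nlinarith⟩
    have := hf.2.2 (k + 1) (by omega) hk1' ⟨x, hx⟩ ⟨y, hy⟩
      (by
        push_cast
        constructor
        · rw [div_lt_iff₀ hp]; linarith
        · rw [lt_div_iff₀ hp]; linarith)
      (by
        push_cast
        constructor
        · rw [div_lt_iff₀ hp]; linarith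
        · rw [lt_div_iff₀ hp]; linarith)
    simpa [extF, hx, hy] using this
  · have aux : ∀ z : ℝ, (k : ℝ) < 2 ^ n * z → 2 ^ n * z < k + 1 → z ∉ Set.Ioo (0 : ℝ) 1 := by
      rintro z hz1 hz2 ⟨hz3, hz4⟩
      apply hk
      constructor
      · have : (-1 : ℝ) < k := by nlinarith
        have : (-1 : ℤ) < k := by exact_mod_cast this
        omega
      · have : (k : ℝ) < 2 ^ n := by nlinarith
        exact_mod_cast this
    rw [extF_out _ (aux x h1 h2), extF_out _ (aux y h3 h4)]

lemma mem_of_grid {n : ℕ} {f : Io01 → ℕ∞} (hft : ∀ t, f t ≠ ⊤) (h : Grid (2 ^ n) (extF f)) :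
    f ∈ Mdyadic n := by
  refine ⟨?_, hft, ?_⟩
  · apply lsc_of_ev
    intro x c hc
    filter_upwards [h.lsc x] with y hy
    rw [extF_coe] at hy
    exact lt_of_lt_of_le hc hy
  · intro k h1 h2 s t hs ht
    have hp : (0 : ℝ) < 2 ^ n := by positivity
    have := h.const ((k : ℤ) - 1) s t
    rw [extF_coe, extF_coe] at this
    have a1 := (div_lt_iff₀ hp).1 hs.1
    have a2 := (lt_div_iff₀ hp).1 hs.2
    have a3 := (div_lt_iff₀ hp).1 ht.1
    have a4 := (lt_div_iff₀ hp).1 ht.2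
    push_cast at this
    exact this (by linarith) (by linarith) (by linarith) (by linarith)

lemma Grid.mul {N : ℕ} {F : ℝ → ℕ∞} (h : Grid N F) (K : ℕ) (hK : 0 < K) : Grid (N * K) F := by
  refine ⟨Nat.mul_pos h.pos hK, h.lsc, ?_⟩
  intro k x y h1 h2 h3 h4
  push_cast at *
  have hK' : (0 : ℝ) < K := by exact_mod_cast hK
  have b1 : (K : ℤ) * (k / K) ≤ k := Int.mul_ediv_self_le (by omega)
  have b2 : k < K * (k / K) + K := Int.lt_mul_ediv_self_add (by omega)
  have b2' : k + 1 ≤ K * (k / K) + K := b2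
  have c1 : (K : ℝ) * ((k / K : ℤ) : ℝ) ≤ k := by exact_mod_cast b1
  have c2 : (k : ℝ) + 1 ≤ K * ((k / K : ℤ) : ℝ) + K := by exact_mod_cast b2'
  apply h.const (k / K)
  · by_contra hh; nlinarith
  · by_contra hh; nlinarith
  · by_contra hh; nlinarith
  · by_contra hh; nlinarith

lemma Mdyadic_mono {l m : ℕ} (hlm : l ≤ m) {f : Io01 → ℕ∞} (hf : f ∈ Mdyadic l) :
    f ∈ Mdyadic m := by
  apply mem_of_grid hf.2.1
  obtain ⟨d, rfl⟩ := Nat.exists_eq_add_of_le hlm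
  rw [pow_add]
  exact (grid_of_mem hf).mul _ (by positivity)

/-- From a property near `p = k/N` to one on the adjacent cells. -/
lemma Grid.near {N : ℕ} {F : ℝ → ℕ∞} (h : Grid N F) (P : ℕ∞ → Prop) (k : ℤ)
    (hP : ∀ᶠ y in 𝓝 ((k : ℝ) / N), P (F y)) (x : ℝ) (hx : |N * x - k| < 1) : P (F x) := by
  have hN : (0 : ℝ) < N := by exact_mod_cast h.pos
  obtain ⟨e, he, hball⟩ := Metric.eventually_nhds_iff.1 hP
  rw [abs_lt] at hx
  rcases lt_trichotomy (N * x) k with hlt | heq | hgt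
  · set d := min (e / 2) (1 / (2 * N)) with hd
    have hd0 : 0 < d := by positivity
    have hd1 : d ≤ e / 2 := min_le_left _ _
    have hd2 : N * d ≤ 1 / 2 := by
      calc N * d ≤ N * (1 / (2 * N)) := by gcongr; exact min_le_right _ _
        _ = 1 / 2 := by field_simp
    have hy : N * ((k : ℝ) / N - d) = k - N * d := by field_simp
    have hNd : 0 < N * d := by positivity
    rw [h.const (k - 1) x ((k : ℝ) / N - d) (by push_cast; linarith) (by push_cast; linarith)
      (by rw [hy]; push_cast; linarith) (by rw [hy]; push_cast; linarith)]
    apply hball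
    rw [Real.dist_eq]
    rw [abs_lt]
    constructor <;> linarith
  · have : x = (k : ℝ) / N := by field_simp; linarith
    rw [this]
    exact hball (by simpa using he)
  · set d := min (e / 2) (1 / (2 * N)) with hd
    have hd0 : 0 < d := by positivity
    have hd1 : d ≤ e / 2 := min_le_left _ _
    have hd2 : N * d ≤ 1 / 2 := by
      calc N * d ≤ N * (1 / (2 * N)) := by gcongr; exact min_le_right _ _
        _ = 1 / 2 := by field_simp
    have hy : N * ((k : ℝ) / N + d) = k + N * d := by field_simp
    have hNd : 0 < N * d := by positivity
    rw [h.const k x ((k : ℝ) / N + d) (by linarith) (by linarith)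
      (by rw [hy]; linarith) (by rw [hy]; linarith)]
    apply hball
    rw [Real.dist_eq]
    rw [abs_lt]
    constructor <;> linarith

lemma Grid.le_near {N : ℕ} {F : ℝ → ℕ∞} (h : Grid N F) (k : ℤ)
    (x : ℝ) (hx : |N * x - k| < 1) : F ((k : ℝ) / N) ≤ F x :=
  h.near (fun c => F ((k : ℝ) / N) ≤ c) k (h.lsc _) x hx

/-- the explicit approximant -/
noncomputable def EE (N : ℕ) (F : ℝ → ℕ∞) (x : ℝ) : ℕ∞ :=
  open Classical in
  if |N * x - round (N * x)| ≤ 1 / 4 then F ((round (N * x) : ℝ) / N) else F x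

lemma round_eq_of {u : ℝ} {k : ℤ} (h : |u - k| < 1 / 2) : round u = k := by
  rw [round_eq, Int.floor_eq_iff]
  rw [abs_lt] at h
  constructor <;> linarith

lemma EE_near {N : ℕ} (F : ℝ → ℕ∞) {x : ℝ} {k : ℤ} (h : |N * x - k| ≤ 1 / 4) :
    EE N F x = F ((k : ℝ) / N) := by
  have : round (N * x) = k := round_eq_of (by linarith)
  unfold EE
  rw [this, if_pos h]

lemma EE_far {N : ℕ} (F : ℝ → ℕ∞) {x : ℝ} {k : ℤ} (h : k + 1 / 4 < N * x)
    (h' : N * x < k + 3 / 4) : EE N F x = F x := by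
  unfold EE
  rw [if_neg]
  intro hh
  rw [abs_le] at hh
  have h1 : (k : ℝ) < round (N * x) := by linarith
  have h2 : (round (N * x) : ℝ) < k + 1 := by linarith
  have h1' : k < round (N * x) := by exact_mod_cast h1
  have h2' : round (N * x) < k + 1 := by exact_mod_cast h2
  omega

lemma EE_cases {N : ℕ} (x : ℝ) : (∃ k : ℤ, |N * x - k| ≤ 1 / 4) ∨
    ∃ k : ℤ, k + 1 / 4 < N * x ∧ N * x < k + 3 / 4 := by
  have h1 := Int.floor_le (N * x)
  have h2 := Int.lt_floor_add_one (N * x)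
  by_cases a : N * x ≤ ⌊N * x⌋ + 1 / 4
  · left
    refine ⟨⌊N * x⌋, ?_⟩
    rw [abs_le]; constructor <;> linarith
  · by_cases b : N * x < ⌊N * x⌋ + 3 / 4
    · right
      exact ⟨_, not_le.1 a, b⟩
    · left
      refine ⟨⌊N * x⌋ + 1, ?_⟩
      push_cast
      rw [abs_le]; constructor <;> linarith

lemma EE_le {N : ℕ} {F : ℝ → ℕ∞} (h : Grid N F) (x : ℝ) : EE N F x ≤ F x := by
  rcases EE_cases (N := N) x with ⟨k, hk⟩ | ⟨k, hk, hk'⟩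
  · rw [EE_near F hk]
    exact h.le_near k x (by linarith)
  · rw [EE_far F hk hk']

lemma cont_mul (N : ℕ) : Continuous (fun y : ℝ => (N : ℝ) * y) := by fun_prop

lemma EE_grid {N : ℕ} {F : ℝ → ℕ∞} (h : Grid N F) : Grid (N * 4) (EE N F) := by
  refine ⟨by have := h.pos; omega, ?_, ?_⟩
  · intro x
    rcases EE_cases (N := N) x with ⟨k, hk⟩ | ⟨k, hk, hk'⟩
    · have ho : ∀ᶠ y in 𝓝 x, |(N : ℝ) * y - k| < 1 / 2 := by
        have hc : Continuous (fun y : ℝ => |(N : ℝ) * y - k|) := by fun_prop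
        exact hc.continuousAt.eventually_lt continuousAt_const (by linarith)
      filter_upwards [ho] with y hy
      rw [EE_near F hk]
      unfold EE
      rw [round_eq_of hy]
      split_ifs
      · exact le_rfl
      · exact h.le_near k y (by linarith)
    · have ho := continuousAt_const.eventually_lt (cont_mul N).continuousAt hk
      have ho' := (cont_mul N).continuousAt.eventually_lt continuousAt_const hk'
      filter_upwards [ho, ho'] with y hy hy'
      rw [EE_far F hk hk', EE_far F hy hy']
      exact (h.const k x y (by linarith) (by linarith) (by linarith) (by linarith)).le
  · intro k x y h1 h2 h3 h4
    push_cast at h1 h2 h3 h4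
    obtain ⟨j, hj⟩ : ∃ j, j = k / 4 := ⟨_, rfl⟩
    have hcases : k = 4 * j ∨ k = 4 * j + 1 ∨ k = 4 * j + 2 ∨ k = 4 * j + 3 := by omega
    rcases hcases with e | e | e | e
    · subst e
      push_cast at h1 h2 h3 h4
      rw [EE_near F (x := x) (k := j) (by rw [abs_le]; constructor <;> linarith),
        EE_near F (x := y) (k := j) (by rw [abs_le]; constructor <;> linarith)]
    · subst e
      push_cast at h1 h2 h3 h4
      rw [EE_far F (x := x) (k := j) (by linarith) (by linarith),
        EE_far F (x := y) (k := j) (by linarith) (by linarith)]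
      exact h.const j x y (by linarith) (by linarith) (by linarith) (by linarith)
    · subst e
      push_cast at h1 h2 h3 h4
      rw [EE_far F (x := x) (k := j) (by linarith) (by linarith),
        EE_far F (x := y) (k := j) (by linarith) (by linarith)]
      exact h.const j x y (by linarith) (by linarith) (by linarith) (by linarith)
    · subst e
      push_cast at h1 h2 h3 h4
      rw [EE_near F (x := x) (k := j + 1) (by push_cast; rw [abs_le]; constructor <;> linarith),
        EE_near F (x := y) (k := j + 1) (by push_cast; rw [abs_le]; constructor <;> linarith)]

lemma EE_wb {N : ℕ} {F : ℝ → ℕ∞} (h : Grid N F) (x : ℝ) : ∀ᶠ y in 𝓝 x, EE N F y ≤ F x := by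
  have hN : (0 : ℝ) < N := by exact_mod_cast h.pos
  have h1 := Int.floor_le (N * x)
  have h2 := Int.lt_floor_add_one (N * x)
  rcases h1.eq_or_lt with e | h1
  · have ho : ∀ᶠ y in 𝓝 x, |(N : ℝ) * y - ⌊N * x⌋| < 1 / 4 := by
      have hc : Continuous (fun y : ℝ => |(N : ℝ) * y - ⌊N * x⌋|) := by fun_prop
      exact hc.continuousAt.eventually_lt continuousAt_const (by rw [e]; simp)
    filter_upwards [ho] with y hy
    rw [EE_near F hy.le]
    have : (⌊N * x⌋ : ℝ) / N = x := by rw [e]; field_simp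
    rw [this]
  · have ho := continuousAt_const.eventually_lt (cont_mul N).continuousAt h1
    have ho' := (cont_mul N).continuousAt.eventually_lt continuousAt_const h2
    filter_upwards [ho, ho'] with y hy hy'
    refine (EE_le h y).trans ?_
    exact (h.const _ y x hy hy' h1 h2).le

lemma EE_upper {N : ℕ} {F G : ℝ → ℕ∞} (hN : 0 < N) (hG : Grid (N * 4) G)
    (hwb : ∀ x, ∀ᶠ y in 𝓝 x, G y ≤ F x) (x : ℝ) : G x ≤ EE N F x := by
  have hN' : (0 : ℝ) < N := by exact_mod_cast hN
  rcases EE_cases (N := N) x with ⟨k, hk⟩ | ⟨k, hk, hk'⟩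
  · rw [EE_near F hk]
    have hk4 : (((4 * k : ℤ) : ℝ) / ((N * 4 : ℕ) : ℝ)) = (k : ℝ) / N := by
      push_cast; field_simp
    have key : ∀ z : ℝ, |((N * 4 : ℕ) : ℝ) * z - ((4 * k : ℤ) : ℝ)| < 1 → G z ≤ F ((k : ℝ) / N) := by
      intro z hz
      refine hG.near (fun c => c ≤ F ((k : ℝ) / N)) (4 * k) ?_ z hz
      rw [hk4]
      exact hwb _
    rw [abs_le] at hk
    by_cases hin : |((N * 4 : ℕ) : ℝ) * x - ((4 * k : ℤ) : ℝ)| < 1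
    · exact key x hin
    · -- endpoint: move to the midpoint
      have hmid : ∃ (j : ℤ) (z : ℝ), x = (j : ℝ) / ((N * 4 : ℕ) : ℝ) ∧
          |((N * 4 : ℕ) : ℝ) * z - j| < 1 ∧
          |((N * 4 : ℕ) : ℝ) * z - ((4 * k : ℤ) : ℝ)| < 1 := by
        push_cast at hin ⊢
        rw [not_lt, le_abs] at hin
        rcases hin with hin | hin
        · refine ⟨4 * k + 1, (4 * k + 1 / 2) / (N * 4), ?_, ?_, ?_⟩
          · push_cast; field_simp; linarith
          · push_cast
            rw [mul_div_cancel₀ _ (by positivity), abs_lt]; constructor <;> linarith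
          · rw [mul_div_cancel₀ _ (by positivity), abs_lt]; constructor <;> linarith
        · refine ⟨4 * k - 1, (4 * k - 1 / 2) / (N * 4), ?_, ?_, ?_⟩
          · push_cast; field_simp; linarith
          · push_cast
            rw [mul_div_cancel₀ _ (by positivity), abs_lt]; constructor <;> linarith
          · rw [mul_div_cancel₀ _ (by positivity), abs_lt]; constructor <;> linarith
      obtain ⟨j, z, hx, hz1, hz2⟩ := hmid
      rw [hx]
      exact (hG.le_near j z hz1).trans (key z hz2)
  · rw [EE_far F hk hk']
    exact (hwb x).self_of_nhds

lemma eps_eq {m : ℕ} {f e : Io01 → ℕ∞} (hf : f ∈ Mdyadic m)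
    (he : IsGreatest {g | g ∈ Mdyadic (m + 2) ∧ WayBelowLsc g f} e) :
    e = fun t : Io01 => EE (2 ^ m) (extF f) t := by
  have hg := grid_of_mem hf
  have hpow : 2 ^ (m + 2) = 2 ^ m * 4 := by rw [pow_add]; norm_num
  have hup := hg.lsc
  have hext : extF (fun t : Io01 => EE (2 ^ m) (extF f) t) = EE (2 ^ m) (extF f) := by
    funext x
    by_cases hx : x ∈ Set.Ioo (0 : ℝ) 1
    · exact extF_coe (fun t : Io01 => EE (2 ^ m) (extF f) t) ⟨x, hx⟩
    · have := EE_le hg x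
      rw [extF_out _ hx] at this
      rw [extF_out _ hx]
      exact (le_antisymm this (zero_le)).symm
  apply le_antisymm
  · intro t
    have h1 := grid_of_mem he.1.1
    rw [hpow] at h1
    have := EE_upper hg.pos h1 (ev_of_wb hf.1 he.1.2) t
    rwa [extF_coe] at this
  · apply he.2
    refine ⟨?_, ?_⟩
    · apply mem_of_grid
      · intro t ht
        have := EE_le hg t
        rw [ht, extF_coe] at this
        exact hf.2.1 t (top_le_iff.1 this)
      · rw [hext, hpow]
        exact EE_grid hg
    · apply wb_of_ev hf.2.1
      intro x _
      rw [hext]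
      exact EE_wb hg x

lemma EE_add (N : ℕ) (F G : ℝ → ℕ∞) (x : ℝ) :
    EE N (fun y => F y + G y) x = EE N F x + EE N G x := by
  unfold EE
  split_ifs <;> rfl

lemma le_of_wb {f g : Io01 → ℕ∞} (hf : IsLscFn f) (h : WayBelowLsc g f) : g ≤ f := by
  obtain ⟨m, hm⟩ := h (fun _ => f) (fun _ => hf) (fun _ _ _ => le_rfl) (fun t => by simp)
  exact hm

/-- `ε_n` is order-preserving and super-additive, and additive on `∪_{l<n-1} M_l`. -/
theorem eps_superadditive_and_additive_on_union
    (eps : ℕ → (Io01 → ℕ∞) → (Io01 → ℕ∞))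
    (heps : ∀ (n : ℕ) (f : Io01 → ℕ∞), 1 ≤ n → IsLscFn f → (∀ t, f t ≠ ⊤) →
      IsGreatest {g | g ∈ Mdyadic n ∧ WayBelowLsc g f} (eps n f))
    (n : ℕ) (hn : 1 ≤ n) :
    (∀ f f' : Io01 → ℕ∞, IsLscFn f → (∀ t, f t ≠ ⊤) → IsLscFn f' → (∀ t, f' t ≠ ⊤) →
      f ≤ f' → eps n f ≤ eps n f') ∧
    (∀ f f' : Io01 → ℕ∞, IsLscFn f → (∀ t, f t ≠ ⊤) → IsLscFn f' → (∀ t, f' t ≠ ⊤) →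
      eps n f + eps n f' ≤ eps n (f + f')) ∧
    (∀ f ∈ MdyadicUnion n, ∀ f' ∈ MdyadicUnion n, eps n (f + f') = eps n f + eps n f') := by
  have mono : ∀ f f' : Io01 → ℕ∞, IsLscFn f → (∀ t, f t ≠ ⊤) → IsLscFn f' → (∀ t, f' t ≠ ⊤) →
      f ≤ f' → eps n f ≤ eps n f' := by
    intro f f' hf hft hf' hft' hle
    obtain ⟨⟨h1, h2⟩, -⟩ := heps n f hn hf hft
    apply (heps n f' hn hf' hft').2
    refine ⟨h1, ?_⟩
    intro H hH hm hs
    exact h2 H hH hm (fun t => (hle t).trans (hs t))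
  have z1 : IsLscFn (0 : Io01 → ℕ∞) := by
    intro m
    simp
  have z2 : ∀ t, (0 : Io01 → ℕ∞) t ≠ ⊤ := by
    intro t
    simp
  have z3 : eps n 0 = 0 := by
    have := le_of_wb z1 (heps n 0 hn z1 z2).1.2
    exact le_antisymm this (fun t => zero_le)
  refine ⟨mono, ?_, ?_⟩
  · intro f f' hf hft hf' hft'
    obtain ⟨⟨h1, h2⟩, -⟩ := heps n f hn hf hft
    obtain ⟨⟨h1', h2'⟩, -⟩ := heps n f' hn hf' hft'
    apply (heps n (f + f') hn (lsc_add hf hft hf' hft') (add_fin hft hft')).2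
    exact ⟨Mdyadic_add h1 h1', wb_add hf hft hf' hft' h2 h2'⟩
  · intro f hf f' hf'
    rcases hf with rfl | hf
    · rw [zero_add, z3, zero_add]
    rcases hf' with rfl | hf'
    · rw [add_zero, z3, add_zero]
    simp only [Set.mem_iUnion, Set.mem_ofPred_eq] at hf hf'
    obtain ⟨l, ⟨hl1, hl2⟩, hf⟩ := hf
    obtain ⟨l', ⟨hl1', hl2'⟩, hf'⟩ := hf'
    obtain ⟨m, rfl⟩ : ∃ m, n = m + 2 := ⟨n - 2, by omega⟩
    have a := Mdyadic_mono (show l ≤ m by omega) hf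
    have a' := Mdyadic_mono (show l' ≤ m by omega) hf'
    have b := Mdyadic_add a a'
    rw [eps_eq a (heps _ f hn a.1 a.2.1), eps_eq a' (heps _ f' hn a'.1 a'.2.1),
      eps_eq b (heps _ (f + f') hn b.1 b.2.1)]
    funext t
    have : extF (f + f') = fun y => extF f y + extF f' y := funext (extF_add f f')
    rw [this, EE_add]
    rfl
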